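/- Let L be an integral domain of characteristic 0 containing ℚ, x ∈ ℚ with 0 ≤ x < 1, r, m, n positive integers, and α_1,…,α_m ∈ L∖{0} pairwise distinct. For each 0 ≤ l ≤ rm, the polynomial P_{n,l}(z) has degree rmn + l, and for all 1 ≤ i ≤ m and 1 ≤ s ≤ r the formal Laurent series R_{l,i,s}(z) := P_{n,l}(z)·Φ_s(x, α_i/z) − P_{n,l,i,s}(z) satisfies R_{l,i,s}(z) = ∑_{k≥0} φ_{α_i,x,s}(t^k·P_{n,l}(t))·z^{−(k+1)}, φ_{α_i,x,s}(t^k·P_{n,l}(t)) = 0 for 0 ≤ k ≤ n−1, and hence ord_∞ R_{l,i,s}(z) ≥ n+1. Thus (P_{n,l}, (P_{n,l,i,s})_{1≤i≤m,1≤s≤r}) is a Padé-type approximant of weight (n,…,n) ∈ ℕ^{rm} and degree rmn+l of the rm series (Φ_s(x, α_i/z))_{i,s}. -/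

import Mathlib

open Polynomial

noncomputable def SPoly (L : Type) [CommRing L] [Algebra ℚ L] (x : ℚ) (n : ℕ)
    (a : Polynomial L) : Polynomial L :=
  a.sum fun k c =>
    Polynomial.C (c * algebraMap ℚ L ((ascPochhammer ℚ n).eval ((k : ℚ) + x + 1) / n.factorial)) *
      Polynomial.X ^ k

noncomputable def phiPoly (L : Type) [CommRing L] [Algebra ℚ L] (α : L) (x : ℚ) (s : ℤ)
    (a : Polynomial L) : L :=
  a.sum fun k c => c * α ^ (k + 1) * algebraMap ℚ L (((k : ℚ) + x + 1) ^ (-s))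

/-- the Padé denominator `P_{n,l}(z) = S_{n,x}^{(r)}(t^l ∏ᵢ (t-αᵢ)^{rn})`. -/
noncomputable def PadeP (L : Type) [CommRing L] [Algebra ℚ L] (x : ℚ) (r m n : ℕ)
    (α : Fin m → L) (l : ℕ) : Polynomial L :=
  (SPoly L x n)^[r] (Polynomial.X ^ l * ∏ i, (Polynomial.X - Polynomial.C (α i)) ^ (r * n))

/-- `P_{n,l,i,s}(z) = φ_{αᵢ,x,s}((P_{n,l}(z)-P_{n,l}(t))/(z-t))`, `φ` acting on `t`. -/
noncomputable def PadeQ (L : Type) [CommRing L] [Algebra ℚ L] (x : ℚ) (r m n : ℕ)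
    (α : Fin m → L) (l : ℕ) (i : Fin m) (s : ℕ) : Polynomial L :=
  let P := PadeP L x r m n α l
  ∑ a ∈ Finset.range (P.natDegree + 1),
    Polynomial.C (∑ b ∈ Finset.range (P.natDegree + 1),
        P.coeff (a + b + 1) * (α i) ^ (b + 1) * algebraMap ℚ L (1 / (((b : ℚ) + x + 1) ^ s))) *
      Polynomial.X ^ a

/-- Laurent series (exponent `t : ℤ` records the coefficient of `z^{-t}`) of a polynomial. -/
noncomputable def polyToLaurent (L : Type) [CommRing L] (P : Polynomial L) : LaurentSeries L :=
  ∑ j ∈ Finset.range (P.natDegree + 1), HahnSeries.single (-(j : ℤ)) (P.coeff j)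

/-- the formal Lerch series `Φ_s(x,α/z) = ∑_{k≥0} α^{k+1}/(k+x+1)^s · z^{-(k+1)}`. -/
noncomputable def lerchLaurent (L : Type) [CommRing L] [Algebra ℚ L] (x : ℚ) (s : ℕ) (α : L) :
    LaurentSeries L :=
  HahnSeries.single (1 : ℤ) (1 : L) *
    HahnSeries.ofPowerSeries ℤ L
      (PowerSeries.mk fun k => α ^ (k + 1) * algebraMap ℚ L (1 / (((k : ℚ) + x + 1) ^ s)))

theorem coeff_SPoly (L : Type) [CommRing L] [Algebra ℚ L] (x : ℚ) (n : ℕ)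
    (a : Polynomial L) (k : ℕ) :
    (SPoly L x n a).coeff k = a.coeff k *
      algebraMap ℚ L ((ascPochhammer ℚ n).eval ((k : ℚ) + x + 1) / n.factorial) := by
  rw [SPoly, Polynomial.sum_def, Polynomial.finsetSum_coeff]
  simp only [Polynomial.coeff_C_mul, Polynomial.coeff_X_pow, mul_ite, mul_one, mul_zero]
  rw [Finset.sum_ite_eq]
  split_ifs with h
  · rfl
  · rw [Polynomial.notMem_support_iff.mp h, zero_mul]

theorem coeff_SPoly_iterate (L : Type) [CommRing L] [Algebra ℚ L] (x : ℚ) (n r : ℕ)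
    (a : Polynomial L) (k : ℕ) :
    ((SPoly L x n)^[r] a).coeff k = a.coeff k *
      algebraMap ℚ L ((ascPochhammer ℚ n).eval ((k : ℚ) + x + 1) / n.factorial) ^ r := by
  induction r with
  | zero => simp
  | succ r ih => rw [Function.iterate_succ_apply', coeff_SPoly, ih, pow_succ, mul_assoc]

theorem degree_SPoly_iterate (L : Type) [CommRing L] [IsDomain L] [Algebra ℚ L] (x : ℚ)
    (hx : 0 ≤ x) (n r : ℕ) (a : Polynomial L) :
    ((SPoly L x n)^[r] a).degree = a.degree := by
  have hsupp : ((SPoly L x n)^[r] a).support = a.support := by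
    ext k
    have hpos : 0 < (ascPochhammer ℚ n).eval ((k : ℚ) + x + 1) / n.factorial :=
      div_pos (ascPochhammer_pos n _ (by positivity)) (by positivity)
    have hne : algebraMap ℚ L
        ((ascPochhammer ℚ n).eval ((k : ℚ) + x + 1) / n.factorial) ≠ 0 := by
      rw [Ne, map_eq_zero_iff _ (algebraMap ℚ L).injective]
      exact hpos.ne'
    simp [Polynomial.mem_support_iff, coeff_SPoly_iterate, hne]
  rw [Polynomial.degree, hsupp, Polynomial.degree]

theorem degree_PadeP (L : Type) [CommRing L] [IsDomain L] [Algebra ℚ L] (x : ℚ)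
    (hx : 0 ≤ x) (r m n : ℕ) (α : Fin m → L) (l : ℕ) :
    (PadeP L x r m n α l).degree = (r * m * n + l : ℕ) := by
  rw [PadeP, degree_SPoly_iterate L x hx, Polynomial.degree_mul, Polynomial.degree_prod]
  simp only [Polynomial.degree_pow, Polynomial.degree_X, Polynomial.degree_X_sub_C]
  simp only [nsmul_eq_mul, mul_one, Finset.sum_const, Finset.card_univ, Fintype.card_fin]
  norm_cast
  ring

theorem sum_coeff_mul_pow_mul_eval_eq_zero {L : Type*} [CommRing L] (a : L) (N : ℕ) :
    ∀ (Q g : Polynomial L), (X - C a) ^ N ∣ Q → g.natDegree < N →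
      ∀ M, Q.natDegree < M →
        ∑ j ∈ Finset.range M, Q.coeff j * a ^ j * g.eval (j : L) = 0 := by
  induction N with
  | zero => intro Q g _ hg; omega
  | succ N ih =>
    intro Q g hQ hg M hM
    have hQa : Q.eval a = 0 := by
      obtain ⟨q, rfl⟩ := hQ
      simp
    have hconst : ∑ j ∈ Finset.range M, Q.coeff j * a ^ j = 0 := by
      rw [← Polynomial.eval_eq_sum_range' hM, hQa]
    have hg' (y : L) : g.eval y = y * g.divX.eval y + g.coeff 0 := by
      have h := congrArg (Polynomial.eval y) (Polynomial.divX_mul_X_add g)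
      simp only [Polynomial.eval_add, Polynomial.eval_mul, Polynomial.eval_X,
        Polynomial.eval_C] at h
      linear_combination -h
    have hsplit : ∑ j ∈ Finset.range M, Q.coeff j * a ^ j * g.eval (j : L) =
        (∑ j ∈ Finset.range M, (X * derivative Q).coeff j * a ^ j * g.divX.eval (j : L)) +
          (∑ j ∈ Finset.range M, Q.coeff j * a ^ j) * g.coeff 0 := by
      rw [Finset.sum_mul, ← Finset.sum_add_distrib]
      refine Finset.sum_congr rfl fun j _ => ?_
      have hc : (X * derivative Q).coeff j = Q.coeff j * (j : L) := by
        cases j with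
        | zero => simp
        | succ j => rw [Polynomial.coeff_X_mul, Polynomial.coeff_derivative]; push_cast; ring
      rw [hc, hg']
      ring
    rw [hsplit, hconst, zero_mul, add_zero]
    rcases Nat.eq_zero_or_pos g.natDegree with h0 | hpos
    · rw [Polynomial.eq_C_of_natDegree_eq_zero h0, Polynomial.divX_C]
      simp
    · refine ih _ _ ?_ ?_ M ?_
      · obtain ⟨q, rfl⟩ := hQ
        refine Dvd.dvd.mul_left ?_ _
        rw [Polynomial.derivative_mul, Polynomial.derivative_X_sub_C_pow]
        refine dvd_add ?_ ?_
        · rw [Nat.add_sub_cancel]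
          exact (dvd_mul_left _ _).mul_right _
        · exact Dvd.dvd.mul_right (pow_dvd_pow _ (Nat.le_succ N)) _
      · rw [Polynomial.natDegree_divX_eq_natDegree_tsub_one]; omega
      · rcases Nat.eq_zero_or_pos Q.natDegree with h | h
        · rw [Polynomial.eq_C_of_natDegree_eq_zero h]; simp; omega
        · have h1 := Polynomial.natDegree_derivative_lt h.ne'
          have h2 := Polynomial.natDegree_mul_le (p := (X : Polynomial L)) (q := derivative Q)
          have h3 := Polynomial.natDegree_X_le (R := L)
          omega

theorem ascPochhammer_eval_eq_prod (n : ℕ) (y : ℚ) :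
    (ascPochhammer ℚ n).eval y = ∏ i ∈ Finset.range n, (y + i) := by
  induction n with
  | zero => simp
  | succ n ih => rw [ascPochhammer_succ_eval, ih, Finset.prod_range_succ]

theorem exists_polynomial_eval_eq_ascPochhammer_pow_div (x : ℚ) (hx : 0 ≤ x) (n r s k : ℕ)
    (hk : k < n) (hs : 1 ≤ s) (hsr : s ≤ r) :
    ∃ g : ℚ[X], g.natDegree < r * n ∧ ∀ j : ℕ,
      g.eval (j : ℚ) = ((ascPochhammer ℚ n).eval ((j : ℚ) + x + 1) / n.factorial) ^ r /
        ((j : ℚ) + k + x + 1) ^ s := by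
  let lin : ℕ → ℚ[X] := fun i => X + C ((i : ℚ) + x + 1)
  have hdeg (t : Finset ℕ) : (∏ i ∈ t, lin i).natDegree ≤ t.card := by
    refine (Polynomial.natDegree_prod_le _ _).trans ?_
    refine (Finset.sum_le_card_nsmul _ _ 1 fun i _ => ?_).trans (by simp)
    exact (Polynomial.natDegree_X_add_C _).le
  refine ⟨C ((1 / (n.factorial : ℚ)) ^ r) * ((∏ i ∈ Finset.range n, lin i) ^ (r - s) *
    (∏ i ∈ (Finset.range n).erase k, lin i) ^ s), ?_, fun j => ?_⟩
  · have hcard : ((Finset.range n).erase k).card = n - 1 := by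
      rw [Finset.card_erase_of_mem (Finset.mem_range.mpr hk), Finset.card_range]
    have h1 := Polynomial.natDegree_pow_le_of_le (r - s) (hdeg (Finset.range n))
    have h2 := Polynomial.natDegree_pow_le_of_le s (hdeg ((Finset.range n).erase k))
    rw [hcard] at h2
    rw [Finset.card_range] at h1
    refine (Polynomial.natDegree_C_mul_le _ _).trans_lt
      ((Polynomial.natDegree_mul_le_of_le h1 h2).trans_lt ?_)
    obtain ⟨d, rfl⟩ := Nat.exists_eq_add_of_le hsr
    obtain ⟨n, rfl⟩ := Nat.exists_eq_add_of_le' (Nat.one_le_of_lt hk)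
    simp only [Nat.add_sub_cancel_left, Nat.add_sub_cancel]
    nlinarith
  · have hpos : (0 : ℚ) < (j : ℚ) + k + x + 1 := by positivity
    have hprod : (ascPochhammer ℚ n).eval ((j : ℚ) + x + 1) =
        ((j : ℚ) + k + x + 1) * (∏ i ∈ (Finset.range n).erase k, lin i).eval (j : ℚ) := by
      rw [ascPochhammer_eval_eq_prod, ← Finset.mul_prod_erase _ _ (Finset.mem_range.mpr hk),
        Polynomial.eval_prod]
      congr 1
      · ring
      · refine Finset.prod_congr rfl fun i _ => ?_
        simp only [lin, Polynomial.eval_add, Polynomial.eval_X, Polynomial.eval_C]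
        ring
    have hprod' : (∏ i ∈ Finset.range n, lin i).eval (j : ℚ) =
        ((j : ℚ) + k + x + 1) * (∏ i ∈ (Finset.range n).erase k, lin i).eval (j : ℚ) := by
      rw [← Finset.mul_prod_erase _ _ (Finset.mem_range.mpr hk), Polynomial.eval_mul]
      congr 1
      simp only [lin, Polynomial.eval_add, Polynomial.eval_X, Polynomial.eval_C]
      ring
    simp only [Polynomial.eval_mul, Polynomial.eval_C, Polynomial.eval_pow]
    rw [hprod, hprod']
    generalize (∏ i ∈ (Finset.range n).erase k, lin i).eval (j : ℚ) = e
    obtain ⟨d, rfl⟩ := Nat.exists_eq_add_of_le hsr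
    rw [Nat.add_sub_cancel_left]
    rw [eq_div_iff (pow_ne_zero _ hpos.ne')]
    generalize (j : ℚ) + k + x + 1 = y
    ring

theorem phiPoly_X_pow_mul (L : Type) [CommRing L] [Algebra ℚ L] (a : L) (x : ℚ) (s : ℤ)
    (k : ℕ) (P : Polynomial L) (M : ℕ) (hM : P.natDegree < M) :
    phiPoly L a x s (X ^ k * P) = ∑ j ∈ Finset.range M,
      P.coeff j * a ^ (j + k + 1) * algebraMap ℚ L (((j : ℚ) + k + x + 1) ^ (-s)) := by
  have hdeg : (X ^ k * P).natDegree < k + M := by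
    have h1 := Polynomial.natDegree_mul_le (p := (X : Polynomial L) ^ k) (q := P)
    have h2 := Polynomial.natDegree_X_pow_le (R := L) k
    omega
  rw [phiPoly, Polynomial.sum_over_range' _ (fun n => by simp) _ hdeg, Finset.sum_range_add,
    Finset.sum_eq_zero, zero_add]
  · refine Finset.sum_congr rfl fun j _ => ?_
    rw [Polynomial.coeff_X_pow_mul', if_pos (Nat.le_add_right k j), Nat.add_sub_cancel_left,
      Nat.cast_add, add_comm k j, add_comm (k : ℚ) j]
  · intro j hj
    rw [Polynomial.coeff_X_pow_mul', if_neg (not_le.mpr (Finset.mem_range.mp hj))]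
    simp

theorem phiPoly_X_pow_mul_PadeP_eq_zero (L : Type) [CommRing L] [Algebra ℚ L]
    (x : ℚ) (hx : 0 ≤ x) (r m n : ℕ) (α : Fin m → L) (l : ℕ) (i : Fin m) (s k : ℕ)
    (hs : 1 ≤ s) (hsr : s ≤ r) (hk : k < n) :
    phiPoly L (α i) x s (X ^ k * PadeP L x r m n α l) = 0 := by
  obtain ⟨g, hg, hgeval⟩ := exists_polynomial_eval_eq_ascPochhammer_pow_div x hx n r s k hk hs hsr
  set Q : Polynomial L := X ^ l * ∏ i, (X - C (α i)) ^ (r * n) with hQ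
  have hdvd : (X - C (α i)) ^ (r * n) ∣ Q :=
    (Finset.dvd_prod_of_mem (fun i => (X - C (α i)) ^ (r * n)) (Finset.mem_univ i)).mul_left _
  have hzero := sum_coeff_mul_pow_mul_eval_eq_zero (α i) (r * n) Q (g.map (algebraMap ℚ L)) hdvd
    (Polynomial.natDegree_map_le.trans_lt hg)
    (max (Q.natDegree + 1) ((PadeP L x r m n α l).natDegree + 1)) (by omega)
  rw [phiPoly_X_pow_mul L (α i) x s k _
    (max (Q.natDegree + 1) ((PadeP L x r m n α l).natDegree + 1)) (by omega)]
  rw [← mul_zero (α i ^ (k + 1)), ← hzero, Finset.mul_sum]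
  refine Finset.sum_congr rfl fun j _ => ?_
  rw [PadeP, coeff_SPoly_iterate, ← hQ, ← map_natCast (algebraMap ℚ L) j,
    Polynomial.eval_map_algebraMap, Polynomial.aeval_algebraMap_apply, Polynomial.coe_aeval_eq_eval,
    hgeval, div_eq_mul_inv _ (((j : ℚ) + k + x + 1) ^ s), map_mul, zpow_neg, zpow_natCast, map_pow]
  ring

theorem coeff_polyToLaurent_mul (L : Type) [CommRing L] (P : Polynomial L) (f : LaurentSeries L)
    (t : ℤ) : (polyToLaurent L P * f).coeff t =
      ∑ j ∈ Finset.range (P.natDegree + 1), P.coeff j * f.coeff (t + j) := by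
  rw [polyToLaurent, Finset.sum_mul, HahnSeries.coeff_sum]
  refine Finset.sum_congr rfl fun j _ => ?_
  rw [HahnSeries.coeff_single_mul, sub_neg_eq_add]

theorem coeff_polyToLaurent_of_pos (L : Type) [CommRing L] (P : Polynomial L) (t : ℤ)
    (ht : 0 < t) : (polyToLaurent L P).coeff t = 0 := by
  rw [polyToLaurent, HahnSeries.coeff_sum]
  refine Finset.sum_eq_zero fun j _ => HahnSeries.coeff_single_of_ne ?_
  omega

theorem coeff_polyToLaurent_neg (L : Type) [CommRing L] (P : Polynomial L) (a : ℕ) :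
    (polyToLaurent L P).coeff (-(a : ℤ)) = P.coeff a := by
  rw [polyToLaurent, HahnSeries.coeff_sum]
  simp only [HahnSeries.coeff_single, neg_inj, Nat.cast_inj]
  rw [Finset.sum_ite_eq]
  split_ifs with h
  · rfl
  · exact (Polynomial.coeff_eq_zero_of_natDegree_lt (by simpa using h)).symm

theorem coeff_lerchLaurent_succ (L : Type) [CommRing L] [Algebra ℚ L] (x : ℚ) (s : ℕ) (a : L)
    (k : ℕ) : (lerchLaurent L x s a).coeff ((k : ℤ) + 1) =
      a ^ (k + 1) * algebraMap ℚ L (1 / (((k : ℚ) + x + 1) ^ s)) := by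
  rw [lerchLaurent, HahnSeries.coeff_single_mul, add_sub_cancel_right, one_mul,
    HahnSeries.ofPowerSeries_apply_coeff, PowerSeries.coeff_mk]

theorem coeff_lerchLaurent_of_nonpos (L : Type) [CommRing L] [Algebra ℚ L] (x : ℚ) (s : ℕ) (a : L)
    (t : ℤ) (ht : t ≤ 0) : (lerchLaurent L x s a).coeff t = 0 := by
  rw [lerchLaurent, HahnSeries.coeff_single_mul, one_mul, HahnSeries.ofPowerSeries_apply]
  refine HahnSeries.embDomain_of_notMem_range ?_
  rintro ⟨j, hj⟩
  have : (j : ℤ) = t - 1 := hj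
  omega

theorem coeff_PadeQ (L : Type) [CommRing L] [Algebra ℚ L] (x : ℚ) (r m n : ℕ)
    (α : Fin m → L) (l : ℕ) (i : Fin m) (s a : ℕ) :
    (PadeQ L x r m n α l i s).coeff a =
      ∑ b ∈ Finset.range ((PadeP L x r m n α l).natDegree + 1),
        (PadeP L x r m n α l).coeff (a + b + 1) * (α i) ^ (b + 1) *
          algebraMap ℚ L (1 / (((b : ℚ) + x + 1) ^ s)) := by
  simp only [PadeQ, Polynomial.finsetSum_coeff, Polynomial.coeff_C_mul, Polynomial.coeff_X_pow,
    mul_ite, mul_one, mul_zero]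
  rw [Finset.sum_ite_eq]
  split_ifs with h
  · rfl
  · refine (Finset.sum_eq_zero fun b _ => ?_).symm
    rw [Finset.mem_range] at h
    rw [Polynomial.coeff_eq_zero_of_natDegree_lt (by omega), zero_mul, zero_mul]

theorem coeff_mul_lerchLaurent_neg (L : Type) [CommRing L] [Algebra ℚ L] (x : ℚ) (s : ℕ) (c : L)
    (P : Polynomial L) (a : ℕ) :
    (polyToLaurent L P * lerchLaurent L x s c).coeff (-(a : ℤ)) =
      ∑ b ∈ Finset.range (P.natDegree + 1), P.coeff (a + b + 1) * c ^ (b + 1) *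
        algebraMap ℚ L (1 / (((b : ℚ) + x + 1) ^ s)) := by
  have hext : ∑ j ∈ Finset.range (P.natDegree + 1),
        P.coeff j * (lerchLaurent L x s c).coeff (-(a : ℤ) + j) =
      ∑ j ∈ Finset.range ((a + 1) + (P.natDegree + 1)),
        P.coeff j * (lerchLaurent L x s c).coeff (-(a : ℤ) + j) := by
    refine Finset.sum_subset (Finset.range_subset_range.mpr (by omega)) fun j _ hj => ?_
    rw [Finset.mem_range] at hj
    rw [Polynomial.coeff_eq_zero_of_natDegree_lt (by omega), zero_mul]
  rw [coeff_polyToLaurent_mul, hext, Finset.sum_range_add, Finset.sum_eq_zero, zero_add]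
  · refine Finset.sum_congr rfl fun b _ => ?_
    rw [show -(a : ℤ) + ((a + 1 + b : ℕ) : ℤ) = (b : ℤ) + 1 by push_cast; ring,
      coeff_lerchLaurent_succ, show a + 1 + b = a + b + 1 by omega, mul_assoc]
  · intro j hj
    rw [Finset.mem_range] at hj
    rw [coeff_lerchLaurent_of_nonpos _ _ _ _ _ (by omega), mul_zero]

theorem coeff_mul_lerchLaurent_succ (L : Type) [CommRing L] [Algebra ℚ L] (x : ℚ) (s : ℕ) (c : L)
    (P : Polynomial L) (k : ℕ) :
    (polyToLaurent L P * lerchLaurent L x s c).coeff ((k : ℤ) + 1) =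
      phiPoly L c x s (X ^ k * P) := by
  rw [coeff_polyToLaurent_mul, phiPoly_X_pow_mul L c x s k P _ (Nat.lt_succ_self _)]
  refine Finset.sum_congr rfl fun j _ => ?_
  rw [show (k : ℤ) + 1 + (j : ℤ) = ((j + k : ℕ) : ℤ) + 1 by push_cast; ring,
    coeff_lerchLaurent_succ, zpow_neg, zpow_natCast, one_div, mul_assoc]
  push_cast
  rfl

theorem stmt6 (L : Type) [CommRing L] [IsDomain L] [Algebra ℚ L]
    (x : ℚ) (hx0 : 0 ≤ x) (hx1 : x < 1) (r m n : ℕ) (hr : 0 < r) (hm : 0 < m) (hn : 0 < n)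
    (α : Fin m → L) (hα : ∀ i, α i ≠ 0) (hinj : Function.Injective α)
    (l : ℕ) (hl : l ≤ r * m) :
    (PadeP L x r m n α l).degree = (r * m * n + l : ℕ) ∧
    ∀ i : Fin m, ∀ s : ℕ, 1 ≤ s → s ≤ r →
      (∀ t : ℤ, t ≤ 0 →
        (polyToLaurent L (PadeP L x r m n α l) * lerchLaurent L x s (α i)
          - polyToLaurent L (PadeQ L x r m n α l i s)).coeff t = 0) ∧
      (∀ k : ℕ,
        (polyToLaurent L (PadeP L x r m n α l) * lerchLaurent L x s (α i)
          - polyToLaurent L (PadeQ L x r m n α l i s)).coeff ((k : ℤ) + 1) =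
          phiPoly L (α i) x s (Polynomial.X ^ k * PadeP L x r m n α l)) ∧
      (∀ k : ℕ, k < n →
        phiPoly L (α i) x s (Polynomial.X ^ k * PadeP L x r m n α l) = 0) ∧
      (∀ t : ℤ, t < (n : ℤ) + 1 →
        (polyToLaurent L (PadeP L x r m n α l) * lerchLaurent L x s (α i)
          - polyToLaurent L (PadeQ L x r m n α l i s)).coeff t = 0) := by
  refine ⟨degree_PadeP L x hx0 r m n α l, fun i s hs hsr => ?_⟩
  have hnonpos : ∀ t : ℤ, t ≤ 0 →
      (polyToLaurent L (PadeP L x r m n α l) * lerchLaurent L x s (α i)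
        - polyToLaurent L (PadeQ L x r m n α l i s)).coeff t = 0 := by
    intro t ht
    obtain ⟨a, rfl⟩ : ∃ a : ℕ, t = -(a : ℤ) := ⟨t.natAbs, by omega⟩
    rw [HahnSeries.coeff_sub, coeff_mul_lerchLaurent_neg, coeff_polyToLaurent_neg, coeff_PadeQ,
      sub_self]
  have hpos : ∀ k : ℕ,
      (polyToLaurent L (PadeP L x r m n α l) * lerchLaurent L x s (α i)
        - polyToLaurent L (PadeQ L x r m n α l i s)).coeff ((k : ℤ) + 1) =
          phiPoly L (α i) x s (Polynomial.X ^ k * PadeP L x r m n α l) := by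
    intro k
    rw [HahnSeries.coeff_sub, coeff_mul_lerchLaurent_succ,
      coeff_polyToLaurent_of_pos _ _ _ (by omega), sub_zero]
  have horth : ∀ k : ℕ, k < n →
      phiPoly L (α i) x s (Polynomial.X ^ k * PadeP L x r m n α l) = 0 :=
    fun k hk => phiPoly_X_pow_mul_PadeP_eq_zero L x hx0 r m n α l i s k hs hsr hk
  refine ⟨hnonpos, hpos, horth, fun t ht => ?_⟩
  rcases le_or_gt t 0 with h | h
  · exact hnonpos t h
  · obtain ⟨k, rfl⟩ : ∃ k : ℕ, t = (k : ℤ) + 1 := ⟨(t - 1).toNat, by omega⟩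
    rw [hpos, horth k (by omega)]
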